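/- For every x ∈ ℝ, the principal value PV∫_ℝ (sin(y)/(1 + y⁴))·(1/(x−y)) dy exists and equals −π·( cos(x) − e^{−1/√2}·( cos(1/√2) + sin(1/√2)·x² ) )/(1 + x⁴). -/

import Mathlib

open MeasureTheory Filter Set Topology

theorem integrable_inv_one_add_pow_four : Integrable fun y : ℝ => (1 + y ^ 4)⁻¹ := by
  refine (integrable_inv_one_add_sq.const_mul 2).mono'
    (Continuous.aestronglyMeasurable ?_) (ae_of_all _ fun y => ?_)
  · exact Continuous.inv₀ (by fun_prop) fun y => by positivity
  · rw [Real.norm_of_nonneg (by positivity), ← div_eq_mul_inv, inv_eq_one_div,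
      div_le_div_iff₀ (by positivity) (by positivity)]
    nlinarith [sq_nonneg (y ^ 2 - 1), sq_nonneg (y ^ 2)]

section Fourier

open FourierTransform Complex

theorem integrable_cexp_neg_mul_abs {c : ℂ} (hc : 0 < c.re) :
    Integrable fun t : ℝ => cexp (-c * (|t| : ℝ)) := by
  rw [← integrableOn_univ, ← Iic_union_Ioi (a := (0 : ℝ))]
  refine IntegrableOn.union ?_ ?_
  · refine (integrableOn_exp_mul_complex_Iic hc 0).congr_fun (fun t ht => ?_) measurableSet_Iic
    simp [abs_of_nonpos (mem_Iic.1 ht)]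
  · refine (integrableOn_exp_mul_complex_Ioi (a := -c) (by simpa using hc) 0).congr_fun
      (fun t ht => ?_) measurableSet_Ioi
    simp [abs_of_pos (mem_Ioi.1 ht)]

theorem fourier_cexp_neg_mul_abs {c : ℂ} (hc : 0 < c.re) (w : ℝ) :
    𝓕 (fun t : ℝ => cexp (-c * (|t| : ℝ))) w
      = 1 / (c + 2 * Real.pi * w * I) + 1 / (c - 2 * Real.pi * w * I) := by
  have hneg : 0 < (c - 2 * Real.pi * w * I).re := by simpa using hc
  have hpos : (-(c + 2 * Real.pi * w * I)).re < 0 := by simpa using hc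
  have hl : EqOn (fun t : ℝ => cexp ((c - 2 * Real.pi * w * I) * t))
      (fun t : ℝ => cexp (↑(-2 * Real.pi * t * w) * I) • cexp (-c * (|t| : ℝ))) (Iic 0) := by
    intro t ht
    simp only [abs_of_nonpos (mem_Iic.1 ht), smul_eq_mul, ← Complex.exp_add]
    congr 1
    push_cast
    ring
  have hr : EqOn (fun t : ℝ => cexp (-(c + 2 * Real.pi * w * I) * t))
      (fun t : ℝ => cexp (↑(-2 * Real.pi * t * w) * I) • cexp (-c * (|t| : ℝ))) (Ioi 0) := by
    intro t ht
    simp only [abs_of_pos (mem_Ioi.1 ht), smul_eq_mul, ← Complex.exp_add]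
    congr 1
    push_cast
    ring
  rw [Real.fourier_real_eq_integral_exp_smul, ← intervalIntegral.integral_Iic_add_Ioi
    ((integrableOn_exp_mul_complex_Iic hneg 0).congr_fun hl measurableSet_Iic)
    ((integrableOn_exp_mul_complex_Ioi hpos 0).congr_fun hr measurableSet_Ioi),
    ← setIntegral_congr_fun measurableSet_Iic hl, ← setIntegral_congr_fun measurableSet_Ioi hr,
    integral_exp_mul_complex_Iic hneg, integral_exp_mul_complex_Ioi hpos]
  simp only [ofReal_zero, mul_zero, Complex.exp_zero, neg_div_neg_eq]
  ring

/-- The inverse Fourier transform of a multiple of `1 / (1 + y ^ 4)`. -/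
noncomputable def quarticKernel (t : ℝ) : ℂ :=
  (1 - I) * cexp (-(Real.pi * √2 * (1 - I)) * (|t| : ℝ))
    + (1 + I) * cexp (-(Real.pi * √2 * (1 + I)) * (|t| : ℝ))

theorem continuous_quarticKernel : Continuous quarticKernel := by
  unfold quarticKernel
  fun_prop

theorem integrable_quarticKernel : Integrable quarticKernel :=
  ((integrable_cexp_neg_mul_abs (by simp; positivity)).const_mul _).add
    ((integrable_cexp_neg_mul_abs (by simp; positivity)).const_mul _)

theorem fourier_quarticKernel (w : ℝ) :
    𝓕 quarticKernel w = ((2 * √2 / Real.pi * (1 + w ^ 4)⁻¹ : ℝ) : ℂ) := by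
  have h1 : 0 < ((Real.pi * √2 * (1 - I) : ℂ)).re := by simp; positivity
  have h2 : 0 < ((Real.pi * √2 * (1 + I) : ℂ)).re := by simp; positivity
  have hk : quarticKernel =
      (1 - I) • (fun t : ℝ => cexp (-(Real.pi * √2 * (1 - I)) * (|t| : ℝ)))
        + (1 + I) • (fun t : ℝ => cexp (-(Real.pi * √2 * (1 + I)) * (|t| : ℝ))) := rfl
  have hadd (f g : ℝ → ℂ) (hf : Integrable f) (hg : Integrable g) (a b : ℂ) :
      𝓕 (a • f + b • g) w = a * 𝓕 f w + b * 𝓕 g w := by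
    have hf' := ((Real.fourierIntegral_convergent_iff w).2 hf).const_mul a
    have hg' := ((Real.fourierIntegral_convergent_iff w).2 hg).const_mul b
    rw [Real.fourier_eq, Real.fourier_eq, Real.fourier_eq, ← integral_const_mul,
      ← integral_const_mul, ← integral_add hf' hg']
    congr 1
    ext v
    simp only [Pi.add_apply, Pi.smul_apply, smul_eq_mul, Circle.smul_def]
    ring
  rw [hk, hadd _ _ (integrable_cexp_neg_mul_abs h1) (integrable_cexp_neg_mul_abs h2),
    fourier_cexp_neg_mul_abs h1, fourier_cexp_neg_mul_abs h2]
  have hne (c : ℂ) (hc : 0 < c.re) : c + 2 * Real.pi * w * I ≠ 0 ∧ c - 2 * Real.pi * w * I ≠ 0 := by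
    constructor <;> intro h <;> apply hc.ne' <;> simpa using congrArg re h
  obtain ⟨h1p, h1m⟩ := hne _ h1
  obtain ⟨h2p, h2m⟩ := hne _ h2
  have hw : (1 + (w : ℂ) ^ 4) ≠ 0 := by
    have : (0 : ℝ) < 1 + w ^ 4 := by positivity
    exact_mod_cast this.ne'
  have hs : ((√2 : ℝ) : ℂ) ^ 2 = 2 := by
    rw [← ofReal_pow, Real.sq_sqrt (by norm_num)]; simp
  have hpi : (Real.pi : ℂ) ≠ 0 := by simp [Real.pi_ne_zero]
  have hI : ((w : ℂ) ^ 2 - I) * (w ^ 2 + I) = 1 + w ^ 4 := by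
    linear_combination -I_sq
  have hm : (w : ℂ) ^ 2 - I ≠ 0 := fun h => hw (by rw [← hI, h, zero_mul])
  have hp : (w : ℂ) ^ 2 + I ≠ 0 := fun h => hw (by rw [← hI, h, mul_zero])
  have e1 : 1 / (Real.pi * √2 * (1 - I) + 2 * Real.pi * w * I)
      + 1 / (Real.pi * √2 * (1 - I) - 2 * Real.pi * w * I)
      = (√2 * (1 - I)) / (2 * Real.pi * (w ^ 2 - I)) := by
    rw [div_add_div _ _ h1p h1m, div_eq_div_iff (mul_ne_zero h1p h1m) (by simp [hpi, hm])]
    linear_combination (-(Real.pi : ℂ) ^ 2 * √2 * (1 - I) ^ 3) * hs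
      + (-2 * (Real.pi : ℂ) ^ 2 * √2 * (1 - I) + 4 * Real.pi ^ 2 * w ^ 2 * √2 * (1 - I)) * I_sq
  have e2 : 1 / (Real.pi * √2 * (1 + I) + 2 * Real.pi * w * I)
      + 1 / (Real.pi * √2 * (1 + I) - 2 * Real.pi * w * I)
      = (√2 * (1 + I)) / (2 * Real.pi * (w ^ 2 + I)) := by
    rw [div_add_div _ _ h2p h2m, div_eq_div_iff (mul_ne_zero h2p h2m) (by simp [hpi, hp])]
    linear_combination (-(Real.pi : ℂ) ^ 2 * √2 * (1 + I) ^ 3) * hs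
      + (-2 * (Real.pi : ℂ) ^ 2 * √2 * (1 + I) + 4 * Real.pi ^ 2 * w ^ 2 * √2 * (1 + I)) * I_sq
  rw [e1, e2]
  push_cast
  rw [← hI]
  field_simp
  linear_combination (2 * (w : ℂ) ^ 2 - 4) * I_sq

theorem integral_cexp_mul_inv_one_add_pow_four {τ : ℝ} (hτ : 0 ≤ τ) :
    ∫ y : ℝ, cexp (τ * y * I) * ((1 + y ^ 4)⁻¹ : ℝ) =
      ((Real.pi / √2 * Real.exp (-(τ / √2)) *
        (Real.cos (τ / √2) + Real.sin (τ / √2)) : ℝ) : ℂ) := by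
  have hF : 𝓕 quarticKernel = fun w : ℝ => ((2 * √2 / Real.pi * (1 + w ^ 4)⁻¹ : ℝ) : ℂ) :=
    funext fourier_quarticKernel
  have hint : Integrable (𝓕 quarticKernel) := by
    rw [hF]
    exact (integrable_inv_one_add_pow_four.const_mul _).ofReal
  have key := congrFun (continuous_quarticKernel.fourierInv_fourier_eq
    integrable_quarticKernel hint) (τ / (2 * Real.pi))
  have hs : ((√2 : ℝ) : ℂ) ^ 2 = 2 := by
    rw [← ofReal_pow, Real.sq_sqrt (by norm_num)]; simp
  have hint' : (𝓕⁻ (𝓕 quarticKernel)) (τ / (2 * Real.pi)) = (2 * √2 / Real.pi : ℝ) *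
      ∫ y : ℝ, cexp (τ * y * I) * ((1 + y ^ 4)⁻¹ : ℝ) := by
    rw [Real.fourierInv_eq', hF, ← integral_const_mul]
    congr 1
    ext y
    simp only [RCLike.inner_apply, conj_trivial, smul_eq_mul]
    have : ((2 * Real.pi * (τ / (2 * Real.pi) * y) : ℝ) : ℂ) = τ * y := by
      push_cast; field_simp
    rw [this]
    push_cast
    ring
  rw [hint'] at key
  have hk : quarticKernel (τ / (2 * Real.pi)) =
      ((2 * Real.exp (-(τ / √2)) * (Real.cos (τ / √2) + Real.sin (τ / √2)) : ℝ) : ℂ) := by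
    have habs : |τ / (2 * Real.pi)| = τ / (2 * Real.pi) := abs_of_nonneg (by positivity)
    have a1 : -(Real.pi * √2 * (1 - I)) * ((τ / (2 * Real.pi) : ℝ) : ℂ)
        = ((-(τ / √2) : ℝ) : ℂ) + ((τ / √2 : ℝ) : ℂ) * I := by
      push_cast; field_simp; rw [hs]; ring
    have a2 : -(Real.pi * √2 * (1 + I)) * ((τ / (2 * Real.pi) : ℝ) : ℂ)
        = ((-(τ / √2) : ℝ) : ℂ) + ((-(τ / √2) : ℝ) : ℂ) * I := by
      push_cast; field_simp; rw [hs]; ring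
    rw [quarticKernel, habs, a1, a2]
    simp only [Complex.exp_add, Complex.exp_mul_I, ← ofReal_exp, ← ofReal_cos, ← ofReal_sin,
      Real.cos_neg, Real.sin_neg]
    push_cast
    linear_combination (-2 * cexp (-(τ / √2)) * Complex.sin (τ / √2)) * I_sq
  rw [hk] at key
  generalize (∫ y : ℝ, cexp (τ * y * I) * ((1 + y ^ 4)⁻¹ : ℝ)) = J at key ⊢
  push_cast at key ⊢
  field_simp at key ⊢
  linear_combination key

end Fourier

theorem integral_cos_add_mul_inv_one_add_pow_four (φ : ℝ) {τ : ℝ} (hτ : 0 ≤ τ) :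
    ∫ y : ℝ, Real.cos (φ + τ * y) * (1 + y ^ 4)⁻¹ =
      Real.cos φ * (Real.pi / √2 * Real.exp (-(τ / √2)) *
        (Real.cos (τ / √2) + Real.sin (τ / √2))) := by
  have hint : Integrable fun y : ℝ =>
      Complex.exp (φ * Complex.I) *
        (Complex.exp (τ * y * Complex.I) * ((1 + y ^ 4)⁻¹ : ℝ)) := by
    refine Integrable.const_mul (integrable_inv_one_add_pow_four.ofReal.bdd_mul (c := 1)
      (Continuous.aestronglyMeasurable (by fun_prop)) (ae_of_all _ fun y => ?_)) _
    rw [← Complex.ofReal_mul, Complex.norm_exp_ofReal_mul_I]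
  have h := integral_re hint
  rw [integral_const_mul, integral_cexp_mul_inv_one_add_pow_four hτ] at h
  convert h using 1
  · congr 1
    ext y
    rw [← mul_assoc, ← Complex.exp_add, ← add_mul, ← Complex.ofReal_mul, ← Complex.ofReal_add,
      RCLike.re_eq_complex_re, Complex.re_mul_ofReal, Complex.exp_ofReal_mul_I_re]
  · rw [RCLike.re_eq_complex_re, Complex.re_mul_ofReal, Complex.exp_ofReal_mul_I_re]

theorem integrable_prod_cos_mul_inv_one_add_pow_four (x : ℝ) :
    Integrable (Function.uncurry fun τ y : ℝ => Real.cos (x + τ * (y - x)) * (1 + y ^ 4)⁻¹)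
      ((volume.restrict (uIoc (0 : ℝ) 1)).prod volume) := by
  have h1 : Integrable (fun _ : ℝ => (1 : ℝ)) (volume.restrict (uIoc (0 : ℝ) 1)) := by
    rw [← IntegrableOn, integrableOn_const_iff]
    simp
  refine ((h1.mul_prod integrable_inv_one_add_pow_four).bdd_mul (c := 1)
    (f := fun z : ℝ × ℝ => Real.cos (x + z.1 * (z.2 - x)))
    (Continuous.aestronglyMeasurable (by fun_prop))
    (ae_of_all _ fun z => Real.abs_cos_le_one _)).congr (ae_of_all _ fun z => ?_)
  simp [Function.uncurry]

theorem integral_cos_mul_quarticKernel (x : ℝ) :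
    ∫ τ in (0 : ℝ)..1, Real.cos (x * (1 - τ)) * (Real.pi / √2 * Real.exp (-(τ / √2)) *
        (Real.cos (τ / √2) + Real.sin (τ / √2))) =
      Real.pi / (1 + x ^ 4) * (Real.cos x + Real.sin x * (x ^ 3 + x) / √2
        - Real.exp (-(1 / √2)) * (Real.cos (1 / √2) + Real.sin (1 / √2) * x ^ 2)) := by
  have hs : √2 ^ 2 = 2 := Real.sq_sqrt (by norm_num)
  have hderiv (τ : ℝ) : HasDerivAt (fun τ : ℝ => -(Real.pi / (1 + x ^ 4)) *
      (Real.exp (-(τ / √2)) *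
        (Real.cos (x * (1 - τ)) * (Real.cos (τ / √2) + x ^ 2 * Real.sin (τ / √2))
        + Real.sin (x * (1 - τ)) * ((x ^ 3 * (Real.cos (τ / √2) + Real.sin (τ / √2))
          + x * (Real.cos (τ / √2) - Real.sin (τ / √2))) / √2))))
      (Real.cos (x * (1 - τ)) * (Real.pi / √2 * Real.exp (-(τ / √2)) *
        (Real.cos (τ / √2) + Real.sin (τ / √2)))) τ := by
    have hd : HasDerivAt (fun τ : ℝ => τ / √2) (1 / √2) τ := (hasDerivAt_id τ).div_const _
    have hx : HasDerivAt (fun τ : ℝ => x * (1 - τ)) (x * -1) τ :=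
      ((hasDerivAt_id τ).const_sub 1).const_mul x
    refine HasDerivAt.congr_deriv ((hd.neg.exp.mul
      ((hx.cos.mul (hd.cos.add (hd.sin.const_mul (x ^ 2)))).add
      (hx.sin.mul ((((hd.cos.add hd.sin).const_mul (x ^ 3)).add
        ((hd.cos.sub hd.sin).const_mul x)).div_const √2)))).const_mul
          (-(Real.pi / (1 + x ^ 4)))) ?_
    simp only [Pi.add_apply, Pi.sub_apply, Pi.mul_apply, Pi.neg_apply]
    generalize Real.cos (x * (1 - τ)) = C, Real.sin (x * (1 - τ)) = S,
      Real.cos (τ / √2) = c, Real.sin (τ / √2) = d, Real.exp (-(τ / √2)) = E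
    field_simp
    linear_combination (-(E * x * (c + x ^ 2 * d) * S)) * hs
  rw [intervalIntegral.integral_eq_sub_of_hasDerivAt (fun τ _ => hderiv τ)
    (Continuous.intervalIntegrable (by fun_prop) _ _)]
  simp only [sub_self, mul_zero, sub_zero, mul_one, zero_div, neg_zero, Real.cos_zero,
    Real.sin_zero, Real.exp_zero]
  ring

theorem integral_inv_one_add_pow_four_mul_integral_cos (x : ℝ) :
    ∫ y : ℝ, ∫ τ in (0 : ℝ)..1, Real.cos (x + τ * (y - x)) * (1 + y ^ 4)⁻¹ =
      Real.pi / (1 + x ^ 4) * (Real.cos x + Real.sin x * (x ^ 3 + x) / √2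
        - Real.exp (-(1 / √2)) * (Real.cos (1 / √2) + Real.sin (1 / √2) * x ^ 2)) := by
  rw [← intervalIntegral_integral_swap (integrable_prod_cos_mul_inv_one_add_pow_four x),
    ← integral_cos_mul_quarticKernel]
  refine intervalIntegral.integral_congr fun τ hτ => ?_
  rw [uIcc_of_le zero_le_one] at hτ
  rw [← integral_cos_add_mul_inv_one_add_pow_four _ hτ.1]
  congr 1
  ext y
  ring_nf

theorem integral_cos_add_mul_sub {x y : ℝ} (h : y ≠ x) :
    ∫ τ in (0 : ℝ)..1, Real.cos (x + τ * (y - x)) = (Real.sin y - Real.sin x) / (y - x) := by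
  have h' : y - x ≠ 0 := sub_ne_zero.2 h
  simp_rw [mul_comm _ (y - x)]
  rw [intervalIntegral.integral_comp_add_mul Real.cos h', integral_cos]
  simp [div_eq_inv_mul]

theorem sq_add_sqrt_two_mul_add_one_pos (y : ℝ) : 0 < y ^ 2 + √2 * y + 1 := by
  have hs : √2 ^ 2 = 2 := Real.sq_sqrt (by norm_num)
  nlinarith [sq_nonneg (y + √2 / 2)]

theorem sq_sub_sqrt_two_mul_add_one_pos (y : ℝ) : 0 < y ^ 2 - √2 * y + 1 := by
  have hs : √2 ^ 2 = 2 := Real.sq_sqrt (by norm_num)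
  nlinarith [sq_nonneg (y - √2 / 2)]

/-- The logarithmic part of the antiderivative of `1 / (1 + y ^ 4)`. -/
noncomputable def quarticLog (y : ℝ) : ℝ :=
  (Real.log (y ^ 2 + √2 * y + 1) - Real.log (y ^ 2 - √2 * y + 1)) / (4 * √2)

/-- The arctangent part of the antiderivative of `1 / (1 + y ^ 4)`. -/
noncomputable def quarticArctan (y : ℝ) : ℝ :=
  (Real.arctan (√2 * y + 1) + Real.arctan (√2 * y - 1)) / (2 * √2)

theorem hasDerivAt_quarticLog (y : ℝ) :
    HasDerivAt quarticLog ((1 - y ^ 2) / (2 * (1 + y ^ 4))) y := by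
  have hs : √2 ^ 2 = 2 := Real.sq_sqrt (by norm_num)
  have hp := (sq_add_sqrt_two_mul_add_one_pos y).ne'
  have hm := (sq_sub_sqrt_two_mul_add_one_pos y).ne'
  have hmul : 1 + y ^ 4 = (y ^ 2 + √2 * y + 1) * (y ^ 2 - √2 * y + 1) := by
    linear_combination y ^ 2 * hs
  have h2 := (hasDerivAt_pow 2 y)
  have h1 := (hasDerivAt_id y).const_mul √2
  refine HasDerivAt.congr_deriv
    (((((h2.add h1).add_const 1).log hp).sub (((h2.sub h1).add_const 1).log hm)).div_const _) ?_
  simp only [Pi.add_apply, Pi.sub_apply, id]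
  have hsum : (y ^ 2 + √2 * y + 1) + (y ^ 2 - √2 * y + 1) = 2 * (1 + y ^ 2) := by ring
  have hdiff : (y ^ 2 + √2 * y + 1) - (y ^ 2 - √2 * y + 1) = 2 * √2 * y := by ring
  rw [hmul]
  generalize y ^ 2 + √2 * y + 1 = P, y ^ 2 - √2 * y + 1 = M at *
  field_simp
  linear_combination 2 * √2 * hsum - 4 * y * hdiff

theorem hasDerivAt_quarticArctan (y : ℝ) :
    HasDerivAt quarticArctan ((1 + y ^ 2) / (2 * (1 + y ^ 4))) y := by
  have hs : √2 ^ 2 = 2 := Real.sq_sqrt (by norm_num)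
  have hp := (sq_add_sqrt_two_mul_add_one_pos y).ne'
  have hm := (sq_sub_sqrt_two_mul_add_one_pos y).ne'
  have hmul : 1 + y ^ 4 = (y ^ 2 + √2 * y + 1) * (y ^ 2 - √2 * y + 1) := by
    linear_combination y ^ 2 * hs
  have h1 := (hasDerivAt_id y).const_mul √2
  refine HasDerivAt.congr_deriv
    (((h1.add_const 1).arctan.add (h1.sub_const 1).arctan).div_const _) ?_
  simp only [id]
  rw [hmul, show 1 + (√2 * y + 1) ^ 2 = 2 * (y ^ 2 + √2 * y + 1) by linear_combination y ^ 2 * hs,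
    show 1 + (√2 * y - 1) ^ 2 = 2 * (y ^ 2 - √2 * y + 1) by linear_combination y ^ 2 * hs]
  have hsum : (y ^ 2 + √2 * y + 1) + (y ^ 2 - √2 * y + 1) = 2 * (1 + y ^ 2) := by ring
  generalize y ^ 2 + √2 * y + 1 = P, y ^ 2 - √2 * y + 1 = M at *
  field_simp
  linear_combination hsum

theorem tendsto_quarticLog {l : Filter ℝ} (hl : Tendsto (fun y : ℝ => y⁻¹) l (𝓝 0))
    (h0 : ∀ᶠ y in l, y ≠ 0) : Tendsto quarticLog l (𝓝 0) := by
  have h : Tendsto (fun u : ℝ => (Real.log (1 + √2 * u + u ^ 2)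
      - Real.log (1 - √2 * u + u ^ 2)) / (4 * √2)) (𝓝 0) (𝓝 0) := by
    have : ContinuousAt (fun u : ℝ => (Real.log (1 + √2 * u + u ^ 2)
      - Real.log (1 - √2 * u + u ^ 2)) / (4 * √2)) 0 := by
      fun_prop (disch := simp)
    simpa [ContinuousAt] using this
  refine (h.comp hl).congr' ?_
  filter_upwards [h0] with y hy
  have hp := sq_add_sqrt_two_mul_add_one_pos y
  have hm := sq_sub_sqrt_two_mul_add_one_pos y
  have e1 : 1 + √2 * y⁻¹ + y⁻¹ ^ 2 = (y ^ 2 + √2 * y + 1) / y ^ 2 := by field_simp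
  have e2 : 1 - √2 * y⁻¹ + y⁻¹ ^ 2 = (y ^ 2 - √2 * y + 1) / y ^ 2 := by field_simp
  simp only [Function.comp_apply, quarticLog]
  rw [e1, e2, Real.log_div hp.ne' (by positivity), Real.log_div hm.ne' (by positivity)]
  ring

theorem tendsto_log_one_add_pow_four_sub_log (x : ℝ) {l : Filter ℝ}
    (hl : Tendsto (fun y : ℝ => y⁻¹) l (𝓝 0)) (h0 : ∀ᶠ y in l, y ≠ 0) (hx : ∀ᶠ y in l, y ≠ x) :
    Tendsto (fun y => Real.log (1 + y ^ 4) / 4 - Real.log (x - y)) l (𝓝 0) := by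
  have h : Tendsto (fun u : ℝ => Real.log (u ^ 4 + 1) / 4 - Real.log (x * u - 1)) (𝓝 0)
      (𝓝 0) := by
    have : ContinuousAt (fun u : ℝ => Real.log (u ^ 4 + 1) / 4 - Real.log (x * u - 1)) 0 := by
      fun_prop (disch := simp)
    simpa [ContinuousAt] using this
  refine (h.comp hl).congr' ?_
  filter_upwards [h0, hx] with y hy hxy
  have hD : 1 + y ^ 4 ≠ 0 := by positivity
  have e1 : y⁻¹ ^ 4 + 1 = (1 + y ^ 4) / y ^ 4 := by field_simp
  have e2 : x * y⁻¹ - 1 = (x - y) / y := by field_simp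
  simp only [Function.comp_apply]
  rw [e1, e2, Real.log_div hD (by positivity), Real.log_div (sub_ne_zero.2 hxy.symm) hy,
    Real.log_pow]
  push_cast
  ring

theorem tendsto_quarticArctan_atTop :
    Tendsto quarticArctan atTop (𝓝 (Real.pi / (2 * √2))) := by
  have h (c : ℝ) : Tendsto (fun y : ℝ => Real.arctan (√2 * y + c)) atTop (𝓝 (Real.pi / 2)) :=
    (tendsto_nhds_of_tendsto_nhdsWithin Real.tendsto_arctan_atTop).comp
      (tendsto_atTop_add_const_right _ _ (tendsto_id.const_mul_atTop (by positivity)))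
  convert ((h 1).add (h (-1))).div_const (2 * √2) using 2
  · rw [quarticArctan, sub_eq_add_neg]
  · rw [add_halves]

theorem quarticArctan_neg (y : ℝ) : quarticArctan (-y) = -quarticArctan y := by
  rw [quarticArctan, quarticArctan, show √2 * -y + 1 = -(√2 * y - 1) by ring,
    show √2 * -y - 1 = -(√2 * y + 1) by ring, Real.arctan_neg, Real.arctan_neg]
  ring

theorem tendsto_quarticArctan_atBot :
    Tendsto quarticArctan atBot (𝓝 (-(Real.pi / (2 * √2)))) :=
  (tendsto_quarticArctan_atTop.comp tendsto_neg_atBot_atTop).neg.congr fun y => by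
    simp [quarticArctan_neg]

/-- The part of the antiderivative of `1 / ((1 + y ^ 4) * (x - y))`, scaled by `1 + x ^ 4`, that is
regular at `x`. -/
noncomputable def quarticRegular (x y : ℝ) : ℝ :=
  Real.log (1 + y ^ 4) / 4 + x ^ 3 * (quarticArctan y + quarticLog y)
    + x ^ 2 * (Real.arctan (y ^ 2) / 2) + x * (quarticArctan y - quarticLog y)

theorem hasDerivAt_quarticRegular (x y : ℝ) :
    HasDerivAt (quarticRegular x) ((x ^ 3 + x ^ 2 * y + x * y ^ 2 + y ^ 3) / (1 + y ^ 4)) y := by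
  have hD : 1 + y ^ 4 ≠ 0 := by positivity
  have hA := hasDerivAt_quarticArctan y
  have hL := hasDerivAt_quarticLog y
  refine HasDerivAt.congr_deriv (((((((hasDerivAt_pow 4 y).const_add 1).log hD).div_const 4).add
    ((hA.add hL).const_mul (x ^ 3))).add (((hasDerivAt_pow 2 y).arctan.div_const 2).const_mul
      (x ^ 2))).add ((hA.sub hL).const_mul x)) ?_
  rw [← pow_mul]
  field_simp
  ring

theorem hasDerivAt_quarticRegular_sub_log {x y : ℝ} (h : y ≠ x) :
    HasDerivAt (fun y => (quarticRegular x y - Real.log (x - y)) / (1 + x ^ 4))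
      ((1 + y ^ 4)⁻¹ * (1 / (x - y))) y := by
  have hxy : x - y ≠ 0 := sub_ne_zero.2 h.symm
  refine HasDerivAt.congr_deriv (((hasDerivAt_quarticRegular x y).sub
    (((hasDerivAt_id y).const_sub x).log hxy)).div_const _) ?_
  simp only [id]
  field_simp
  ring

theorem tendsto_quarticRegular_sub_log (x : ℝ) {l : Filter ℝ} {θ : ℝ}
    (hl : Tendsto (fun y : ℝ => y⁻¹) l (𝓝 0)) (h0 : ∀ᶠ y in l, y ≠ 0) (hx : ∀ᶠ y in l, y ≠ x)
    (hθ : Tendsto quarticArctan l (𝓝 θ)) (hsq : Tendsto (fun y : ℝ => y ^ 2) l atTop) :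
    Tendsto (fun y => (quarticRegular x y - Real.log (x - y)) / (1 + x ^ 4)) l
      (𝓝 (((x ^ 3 + x) * θ + x ^ 2 * (Real.pi / 4)) / (1 + x ^ 4))) := by
  have hA := ((tendsto_nhds_of_tendsto_nhdsWithin Real.tendsto_arctan_atTop).comp
    hsq).const_mul (x ^ 2 / 2)
  have hL := (tendsto_quarticLog hl h0).const_mul (x ^ 3 - x)
  convert ((((tendsto_log_one_add_pow_four_sub_log x hl h0 hx).add
    (hθ.const_mul (x ^ 3 + x))).add hA).add hL).div_const (1 + x ^ 4) using 2
  · simp only [quarticRegular, Function.comp_apply]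
    ring
  · ring

theorem measurableSet_lt_abs_sub (x ε : ℝ) : MeasurableSet {y : ℝ | ε < |y - x|} :=
  measurableSet_lt measurable_const (by fun_prop)

theorem setOf_lt_abs_sub (x ε : ℝ) : {y : ℝ | ε < |y - x|} = Iio (x - ε) ∪ Ioi (x + ε) := by
  ext y
  simp only [mem_ofPred_eq, mem_union, mem_Iio, mem_Ioi, lt_abs]
  constructor <;> rintro (h | h) <;> first | (left; linarith) | (right; linarith)

theorem integrableOn_inv_one_add_pow_four_mul_inv_sub (x : ℝ) {ε : ℝ} (hε : 0 < ε) :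
    IntegrableOn (fun y : ℝ => (1 + y ^ 4)⁻¹ * (1 / (x - y))) {y : ℝ | ε < |y - x|} := by
  refine Integrable.mul_bdd (c := 1 / ε) integrable_inv_one_add_pow_four.integrableOn
    (Measurable.aestronglyMeasurable (by fun_prop)) ?_
  filter_upwards [ae_restrict_mem (measurableSet_lt_abs_sub x ε)] with y hy
  rw [Real.norm_eq_abs, abs_div, abs_one, abs_sub_comm]
  exact one_div_le_one_div_of_le hε hy.le

theorem setIntegral_inv_one_add_pow_four_mul_inv_sub (x : ℝ) {ε : ℝ} (hε : 0 < ε) :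
    ∫ y in {y : ℝ | ε < |y - x|}, (1 + y ^ 4)⁻¹ * (1 / (x - y)) =
      (quarticRegular x (x - ε) - quarticRegular x (x + ε)
        + (x ^ 3 + x) * (Real.pi / √2)) / (1 + x ^ 4) := by
  have hint := integrableOn_inv_one_add_pow_four_mul_inv_sub x hε
  rw [setOf_lt_abs_sub] at hint ⊢
  have hint1 := hint.mono_set subset_union_left
  have hint2 := hint.mono_set subset_union_right
  rw [setIntegral_union ((Iio_disjoint_Ici (by linarith)).mono_right Ioi_subset_Ici_self)
      measurableSet_Ioi hint1 hint2,
    ← integral_Iic_eq_integral_Iio,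
    integral_Ioi_of_hasDerivAt_of_tendsto' (fun y hy => hasDerivAt_quarticRegular_sub_log
      (by rw [mem_Ici] at hy; linarith)) hint2
      (tendsto_quarticRegular_sub_log x tendsto_inv_atTop_zero (eventually_ne_atTop 0)
        (eventually_ne_atTop x) tendsto_quarticArctan_atTop (tendsto_pow_atTop (by norm_num))),
    integral_Iic_of_hasDerivAt_of_tendsto' (fun y hy => hasDerivAt_quarticRegular_sub_log
      (by rw [mem_Iic] at hy; linarith))
      ((integrableOn_Iic_iff_integrableOn_Iio enorm_ne_top).2 hint1)
      (tendsto_quarticRegular_sub_log x tendsto_inv_atBot_zero (eventually_ne_atBot 0)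
        (eventually_ne_atBot x) tendsto_quarticArctan_atBot
        (((tendsto_pow_atTop two_ne_zero).comp tendsto_abs_atBot_atTop).congr fun y => sq_abs y)),
    sub_sub_cancel, sub_add_cancel_left, Real.log_neg_eq_log]
  ring

theorem tendsto_setIntegral_inv_one_add_pow_four_mul_inv_sub (x : ℝ) :
    Tendsto (fun ε : ℝ => ∫ y in {y : ℝ | ε < |y - x|}, (1 + y ^ 4)⁻¹ * (1 / (x - y)))
      (𝓝[>] 0) (𝓝 (((x ^ 3 + x) * (Real.pi / √2)) / (1 + x ^ 4))) := by
  have hc : Continuous (quarticRegular x) :=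
    continuous_iff_continuousAt.2 fun y => (hasDerivAt_quarticRegular x y).continuousAt
  have h : Tendsto (fun ε : ℝ => (quarticRegular x (x - ε) - quarticRegular x (x + ε)
      + (x ^ 3 + x) * (Real.pi / √2)) / (1 + x ^ 4)) (𝓝 0)
      (𝓝 (((x ^ 3 + x) * (Real.pi / √2)) / (1 + x ^ 4))) := by
    have : Continuous fun ε : ℝ => (quarticRegular x (x - ε) - quarticRegular x (x + ε)
      + (x ^ 3 + x) * (Real.pi / √2)) / (1 + x ^ 4) := by fun_prop
    simpa using this.tendsto 0
  refine (h.mono_left nhdsWithin_le_nhds).congr' ?_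
  filter_upwards [self_mem_nhdsWithin] with ε hε
  rw [setIntegral_inv_one_add_pow_four_mul_inv_sub x hε]

theorem aecover_lt_abs_sub (x : ℝ) :
    AECover volume (𝓝[>] (0 : ℝ)) fun ε : ℝ => {y : ℝ | ε < |y - x|} where
  ae_eventually_mem := by
    filter_upwards [Measure.ae_ne volume x] with y hy
    exact nhdsWithin_le_nhds (Iio_mem_nhds (abs_pos.2 (sub_ne_zero.2 hy)))
  measurableSet := measurableSet_lt_abs_sub x

/-- For every `x ∈ ℝ`, the principal value
`PV∫_ℝ (sin(y)/(1 + y⁴))·(1/(x−y)) dy` exists and equals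
`−π·(cos(x) − e^{−1/√2}·(cos(1/√2) + sin(1/√2)·x²))/(1 + x⁴)`. -/
theorem pv_sin_quartic (x : ℝ) :
    Tendsto
      (fun ε : ℝ => ∫ y in {y : ℝ | ε < |y - x|},
        (Real.sin y / (1 + y ^ 4)) * (1 / (x - y)))
      (𝓝[>] 0)
      (𝓝 (-(Real.pi * (Real.cos x - Real.exp (-(1 / Real.sqrt 2))
        * (Real.cos (1 / Real.sqrt 2) + Real.sin (1 / Real.sqrt 2) * x ^ 2))
        / (1 + x ^ 4)))) := by
  have hq : Integrable fun y : ℝ =>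
      ∫ τ in (0 : ℝ)..1, Real.cos (x + τ * (y - x)) * (1 + y ^ 4)⁻¹ := by
    have h := (integrable_prod_cos_mul_inv_one_add_pow_four x).integral_prod_right
    rw [uIoc_of_le zero_le_one] at h
    simpa only [intervalIntegral.integral_of_le zero_le_one, Function.uncurry] using h
  have hlim := ((tendsto_setIntegral_inv_one_add_pow_four_mul_inv_sub x).const_mul
    (Real.sin x)).sub ((aecover_lt_abs_sub x).integral_tendsto_of_countably_generated hq)
  rw [integral_inv_one_add_pow_four_mul_integral_cos] at hlim
  convert hlim.congr' ?_ using 2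
  · ring
  filter_upwards [self_mem_nhdsWithin] with ε hε
  rw [← integral_const_mul, ← integral_sub
    ((integrableOn_inv_one_add_pow_four_mul_inv_sub x hε).const_mul _) hq.integrableOn]
  refine setIntegral_congr_fun (measurableSet_lt_abs_sub x ε) fun y hy => ?_
  have hyx : y ≠ x := by
    rintro rfl
    exact absurd hy (by simpa using (mem_Ioi.1 hε).le)
  rw [intervalIntegral.integral_mul_const, integral_cos_add_mul_sub hyx, ← neg_sub x y]
  field_simp
  ring
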